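/- arXiv:1912.03843 — 2 statements merged into one kernel-verified Lean document; each statement's English description precedes it below -/
import Mathlib

section
/- (Homotopy equivalence promotes to strong homotopy equivalence) Let X, Y be cochain complexes with homotopy-equivalence data f₀, g₀, h₀, k₀ (d(f₀) = d(g₀) = 0, d(h₀) = id_X − g₀f₀, d(k₀) = id_Y − f₀g₀). Then after possibly replacing h₀ by h₀' := h₀ − g₀(f₀h₀ − k₀f₀), there exist power series f(ε), g(ε), h(ε), k(ε) in a formal degree-2 variable ε, with constant terms f₀, g₀, h₀', k₀, satisfying d(f) = ε(fh − kf), d(g) = ε(gk − hg), d(h) = id_X − gf − εh², d(k) = id_Y − fg − εk². -/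
open CategoryTheory CochainComplex CochainComplex.HomComplex

noncomputable section

variable {R : Type*} [CommRing R]

/-- A formal power series in a degree-2 variable `ε` of total degree `d`:
the coefficient of `ε^i` is a cochain of degree `d - 2i`. -/
abbrev SHom (X Y : CochainComplex (ModuleCat R) ℤ) (d : ℤ) :=
  ∀ i : ℕ, Cochain X Y (d - 2 * (i : ℤ))

variable {X Y Z : CochainComplex (ModuleCat R) ℤ} {d d₁ d₂ d₃ e : ℤ}

/-- The differential, applied coefficientwise (intended for `e = d + 1`,
following the convention of `CochainComplex.HomComplex.δ`). -/
def sδ (d e : ℤ) (a : SHom X Y d) : SHom X Y e :=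
  fun i => δ (d - 2 * (i : ℤ)) (e - 2 * (i : ℤ)) (a i)

/-- Composition (written diagrammatically) of formal series, by convolution. -/
def sComp (a : SHom X Y d₁) (b : SHom Y Z d₂) (h : d₁ + d₂ = d₃) : SHom X Z d₃ :=
  fun n => ∑ i ∈ (Finset.range (n + 1)).attach,
    (a i.1).comp (b (n - i.1))
      (by have hi := i.2; rw [Finset.mem_range] at hi; omega)

/-- The identity, as a formal series. -/
def sOne (X : CochainComplex (ModuleCat R) ℤ) : SHom X X 0 :=
  fun i => if h : i = 0 then
    (Cochain.ofHom (𝟙 X)).comp (Cochain.ofHom (𝟙 X)) (by omega) else 0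

/-- A single cochain, viewed as a constant formal series. -/
def sSingle (z : Cochain X Y d) : SHom X Y d :=
  fun i => if h : i = 0 then z.comp (Cochain.ofHom (𝟙 Y)) (by omega) else 0

/-- Multiplication by `ε` (which has degree `2`). -/
def sEps (a : SHom X Y d) (h : d + 2 = e) : SHom X Y e :=
  fun n => if hn : n = 0 then 0
    else (a (n - 1)).comp (Cochain.ofHom (𝟙 Y)) (by omega)

set_option linter.unusedSimpArgs false

section Core

open Finset

lemma shAux_pow {A : Type*} [Ring A] (D H : A) (h : D * H + H * D = 1) (n : ℕ) :
    D * H ^ (2 * n + 1) + H ^ (2 * n + 1) * D = H ^ (2 * n) := by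
  have hc : Commute D (H ^ 2) := by
    have h1 : D * H = 1 - H * D := by rw [← h]; abel
    show D * H ^ 2 = H ^ 2 * D
    calc D * H ^ 2 = (D * H) * H := by rw [pow_two, mul_assoc]
      _ = H - H * (D * H) := by
        conv_lhs => rw [h1, sub_mul, one_mul, mul_assoc]
      _ = H ^ 2 * D := by rw [h1, mul_sub, mul_one, pow_two, mul_assoc]; abel
  have hc2 : D * H ^ (2 * n) = H ^ (2 * n) * D := by
    rw [pow_mul]; exact (hc.pow_right n)
  calc D * H ^ (2 * n + 1) + H ^ (2 * n + 1) * D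
      = (D * H ^ (2 * n)) * H + (H ^ (2 * n) * H) * D   := by rw [pow_succ, ← mul_assoc]
    _ = H ^ (2 * n) * (D * H + H * D) := by rw [hc2, mul_add, mul_assoc, mul_assoc]
    _ = _ := by rw [h, mul_one]

/-- signed Catalan numbers -/
def shCoef (n : ℕ) : ℤ := (-1) ^ n * (catalan n : ℤ)

lemma shCoef_succ (n : ℕ) :
    ∑ p ∈ antidiagonal n, shCoef p.1 * shCoef p.2 = - shCoef (n + 1) := by
  have : ∀ p ∈ antidiagonal n, shCoef p.1 * shCoef p.2
      = (-1) ^ n * ((catalan p.1 * catalan p.2 : ℕ) : ℤ) := by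
    intro p hp
    rw [HasAntidiagonal.mem_antidiagonal] at hp
    subst hp
    simp only [shCoef]; push_cast; ring
  rw [sum_congr rfl this, ← mul_sum, ← Nat.cast_sum, ← catalan_succ', shCoef]
  ring

/-- The terms of the series `H(ε)`. -/
def shTerm {A : Type*} [Ring A] (H : A) (n : ℕ) : A := shCoef n • H ^ (2 * n + 1)

lemma shTerm_zero {A : Type*} [Ring A] (H : A) : shTerm H 0 = H := by
  simp [shTerm, shCoef]

lemma shTerm_eq_zero {A : Type*} [Ring A] (D H : A) (h : D * H + H * D = 1) :
    D * shTerm H 0 + shTerm H 0 * D = 1 := by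
  rw [shTerm_zero, h]

lemma shTerm_eq_succ {A : Type*} [Ring A] (D H : A) (h : D * H + H * D = 1) (n : ℕ) :
    D * shTerm H (n + 1) + shTerm H (n + 1) * D
      = - ∑ p ∈ antidiagonal n, shTerm H p.1 * shTerm H p.2 := by
  have : ∀ p ∈ antidiagonal n, shTerm H p.1 * shTerm H p.2
      = (shCoef p.1 * shCoef p.2) • H ^ (2 * (n + 1)) := by
    intro p hp
    rw [HasAntidiagonal.mem_antidiagonal] at hp
    subst hp
    simp only [shTerm]
    rw [smul_mul_smul_comm, ← pow_add]
    congr 2; ring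
  rw [sum_congr rfl this, ← sum_smul, shCoef_succ, neg_smul, neg_neg]
  simp only [shTerm]
  rw [mul_smul_comm, smul_mul_assoc, ← smul_add, shAux_pow D H h]

variable {S M N : Type*} [CommRing S] [AddCommGroup M] [AddCommGroup N] [Module S M] [Module S N]

open LinearMap

/-- Block `(1,1)`. -/
def b11 (B : Module.End S (M × N)) : M →ₗ[S] M := fst S M N ∘ₗ B ∘ₗ inl S M N
/-- Block `(1,2)`. -/
def b12 (B : Module.End S (M × N)) : N →ₗ[S] M := fst S M N ∘ₗ B ∘ₗ inr S M N
/-- Block `(2,1)`. -/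
def b21 (B : Module.End S (M × N)) : M →ₗ[S] N := snd S M N ∘ₗ B ∘ₗ inl S M N
/-- Block `(2,2)`. -/
def b22 (B : Module.End S (M × N)) : N →ₗ[S] N := snd S M N ∘ₗ B ∘ₗ inr S M N

lemma b_split (B : Module.End S (M × N)) (x : M) (y : N) :
    B (x, y) = (b11 B x + b12 B y, b21 B x + b22 B y) := by
  have : (x, y) = ((x, 0) : M × N) + (0, y) := by simp
  rw [this, map_add]
  ext <;> simp [b11, b12, b21, b22]

lemma b11_mul (A B : Module.End S (M × N)) :
    b11 (A * B) = b11 A ∘ₗ b11 B + b12 A ∘ₗ b21 B := by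
  ext1 x
  change (A (B (x, 0))).1 = _
  rw [b_split B, b_split A]
  simp
lemma b12_mul (A B : Module.End S (M × N)) :
    b12 (A * B) = b11 A ∘ₗ b12 B + b12 A ∘ₗ b22 B := by
  ext1 x
  change (A (B (0, x))).1 = _
  rw [b_split B, b_split A]
  simp
lemma b21_mul (A B : Module.End S (M × N)) :
    b21 (A * B) = b21 A ∘ₗ b11 B + b22 A ∘ₗ b21 B := by
  ext1 x
  change (A (B (x, 0))).2 = _
  rw [b_split B, b_split A]
  simp
lemma b22_mul (A B : Module.End S (M × N)) :
    b22 (A * B) = b21 A ∘ₗ b12 B + b22 A ∘ₗ b22 B := by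
  ext1 x
  change (A (B (0, x))).2 = _
  rw [b_split B, b_split A]
  simp

lemma b_ext {A B : Module.End S (M × N)} (h1 : b11 A = b11 B) (h2 : b12 A = b12 B)
    (h3 : b21 A = b21 B) (h4 : b22 A = b22 B) : A = B := by
  refine LinearMap.ext fun ⟨x, y⟩ => ?_
  rw [b_split A, b_split B, h1, h2, h3, h4]

/-- Block endomorphisms. -/
def blk (a : M →ₗ[S] M) (b : N →ₗ[S] M) (c : M →ₗ[S] N) (e : N →ₗ[S] N) :
    Module.End S (M × N) := (coprod a b).prod (coprod c e)

section
variable (a : M →ₗ[S] M) (b : N →ₗ[S] M) (c : M →ₗ[S] N) (e : N →ₗ[S] N)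
lemma b11_blk : b11 (blk a b c e) = a := by ext; simp [b11, blk]
lemma b12_blk : b12 (blk a b c e) = b := by ext; simp [b12, blk]
lemma b21_blk : b21 (blk a b c e) = c := by ext; simp [b21, blk]
lemma b22_blk : b22 (blk a b c e) = e := by ext; simp [b22, blk]
end

section
variable (A B : Module.End S (M × N))
lemma b11_add : b11 (A + B) = b11 A + b11 B := by ext; simp [b11]
lemma b12_add : b12 (A + B) = b12 A + b12 B := by ext; simp [b12]
lemma b21_add : b21 (A + B) = b21 A + b21 B := by ext; simp [b21]
lemma b22_add : b22 (A + B) = b22 A + b22 B := by ext; simp [b22]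
lemma b11_neg : b11 (-A) = -b11 A := by ext; simp [b11]
lemma b12_neg : b12 (-A) = -b12 A := by ext; simp [b12]
lemma b21_neg : b21 (-A) = -b21 A := by ext; simp [b21]
lemma b22_neg : b22 (-A) = -b22 A := by ext; simp [b22]
lemma b11_one : b11 (1 : Module.End S (M × N)) = LinearMap.id := by ext; simp [b11]
lemma b12_one : b12 (1 : Module.End S (M × N)) = 0 := by ext; simp [b12]
lemma b21_one : b21 (1 : Module.End S (M × N)) = 0 := by ext; simp [b21]
lemma b22_one : b22 (1 : Module.End S (M × N)) = LinearMap.id := by ext; simp [b22]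
variable {ι : Type*} (s : Finset ι) (C : ι → Module.End S (M × N))
lemma b11_sum : b11 (∑ i ∈ s, C i) = ∑ i ∈ s, b11 (C i) :=
  map_sum (AddMonoidHom.mk' b11 b11_add : Module.End S (M × N) →+ _) C s
lemma b12_sum : b12 (∑ i ∈ s, C i) = ∑ i ∈ s, b12 (C i) :=
  map_sum (AddMonoidHom.mk' b12 b12_add : Module.End S (M × N) →+ _) C s
lemma b21_sum : b21 (∑ i ∈ s, C i) = ∑ i ∈ s, b21 (C i) :=
  map_sum (AddMonoidHom.mk' b21 b21_add : Module.End S (M × N) →+ _) C s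
lemma b22_sum : b22 (∑ i ∈ s, C i) = ∑ i ∈ s, b22 (C i) :=
  map_sum (AddMonoidHom.mk' b22 b22_add : Module.End S (M × N) →+ _) C s
end

/-- The contracting homotopy of the cone. -/
def shH (f : M →ₗ[S] N) (g : N →ₗ[S] M) (h : M →ₗ[S] M) (k : N →ₗ[S] N) :
    Module.End S (M × N) :=
  blk (-(h - g ∘ₗ (f ∘ₗ h - k ∘ₗ f))) g (k ∘ₗ (f ∘ₗ h - k ∘ₗ f)) k

lemma shH_contracting (dM : M →ₗ[S] M) (dN : N →ₗ[S] N)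
    (f : M →ₗ[S] N) (g : N →ₗ[S] M) (h : M →ₗ[S] M) (k : N →ₗ[S] N)
    (hf : dN ∘ₗ f - f ∘ₗ dM = 0) (hg : dM ∘ₗ g - g ∘ₗ dN = 0)
    (hh : dM ∘ₗ h + h ∘ₗ dM = LinearMap.id - g ∘ₗ f)
    (hk : dN ∘ₗ k + k ∘ₗ dN = LinearMap.id - f ∘ₗ g) :
    blk (-dM) 0 f dN * shH f g h k + shH f g h k * blk (-dM) 0 f dN = 1 := by
  have hf' : ∀ x, dN (f x) = f (dM x) := fun x => by
    simpa [sub_eq_zero] using LinearMap.congr_fun hf x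
  have hg' : ∀ x, dM (g x) = g (dN x) := fun x => by
    simpa [sub_eq_zero] using LinearMap.congr_fun hg x
  have hh' : ∀ x, dM (h x) = x - g (f x) - h (dM x) := fun x => by
    have := LinearMap.congr_fun hh x
    simp only [LinearMap.add_apply, LinearMap.sub_apply, LinearMap.comp_apply,
      LinearMap.id_apply] at this
    rw [← this]; abel
  have hk' : ∀ x, dN (k x) = x - f (g x) - k (dN x) := fun x => by
    have := LinearMap.congr_fun hk x
    simp only [LinearMap.add_apply, LinearMap.sub_apply, LinearMap.comp_apply,
      LinearMap.id_apply] at this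
    rw [← this]; abel
  apply b_ext
  · rw [b11_add, b11_mul, b11_mul, b11_one]
    simp only [shH, b11_blk, b12_blk, b21_blk, b22_blk]
    ext1 x
    simp [hf', hg', hh', hk']
    abel
  · rw [b12_add, b12_mul, b12_mul, b12_one]
    simp only [shH, b11_blk, b12_blk, b21_blk, b22_blk]
    ext1 x
    simp [hf', hg', hh', hk']
  · rw [b21_add, b21_mul, b21_mul, b21_one]
    simp only [shH, b11_blk, b12_blk, b21_blk, b22_blk]
    ext1 x
    simp [hf', hg', hh', hk']
    abel
  · rw [b22_add, b22_mul, b22_mul, b22_one]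
    simp only [shH, b11_blk, b12_blk, b21_blk, b22_blk]
    ext1 x
    simp [hf', hg', hh', hk']
    abel

/-- The series `f`. -/
def shF (f : M →ₗ[S] N) (H : Module.End S (M × N)) : ℕ → (M →ₗ[S] N)
  | 0 => f
  | n + 1 => b21 (shTerm H n)

section
variable (dM : M →ₗ[S] M) (dN : N →ₗ[S] N) (f : M →ₗ[S] N) (H : Module.End S (M × N))

lemma sh_f_succ (hH : blk (-dM) 0 f dN * H + H * blk (-dM) 0 f dN = 1) (n : ℕ) :
    dN ∘ₗ shF f H (n + 1) - shF f H (n + 1) ∘ₗ dM =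
      ∑ p ∈ antidiagonal n, shF f H p.2 ∘ₗ (-b11 (shTerm H p.1))
      - ∑ p ∈ antidiagonal n, b22 (shTerm H p.2) ∘ₗ shF f H p.1 := by
  cases n with
  | zero =>
    have := congrArg b21 (shTerm_eq_zero _ _ hH)
    simp only [b21_add, b21_mul, b11_blk, b12_blk, b21_blk, b22_blk, b21_one] at this
    simp only [shF, HasAntidiagonal.antidiagonal_zero, sum_singleton]
    rw [← sub_eq_zero, ← this]
    ext1 x
    simp
    abel
  | succ n =>
    have := congrArg b21 (shTerm_eq_succ _ _ hH n)
    simp only [b21_add, b21_mul, b11_blk, b12_blk, b21_blk, b22_blk, b21_neg, b21_sum,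
      sum_add_distrib] at this
    rw [Nat.sum_antidiagonal_succ', Nat.sum_antidiagonal_succ]
    simp only [shF]
    rw [← Nat.sum_antidiagonal_swap (n := n)
      (f := fun p => b22 (shTerm H p.2) ∘ₗ b21 (shTerm H p.1)),
      ← Nat.sum_antidiagonal_swap (n := n)
      (f := fun p => b21 (shTerm H p.2) ∘ₗ (-b11 (shTerm H p.1)))]
    simp only [Prod.fst_swap, Prod.snd_swap, LinearMap.comp_neg, sum_neg_distrib] at this ⊢
    rw [← sub_eq_zero] at this
    rw [← sub_eq_zero, ← this]
    abel

lemma sh_g_zero (hH : blk (-dM) 0 f dN * H + H * blk (-dM) 0 f dN = 1) :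
    dM ∘ₗ b12 (shTerm H 0) - b12 (shTerm H 0) ∘ₗ dN = 0 := by
  have := congrArg b12 (shTerm_eq_zero _ _ hH)
  simp only [b12_add, b12_mul, b11_blk, b12_blk, b21_blk, b22_blk, b12_one] at this
  rw [← neg_eq_zero, ← this]
  ext1 x
  simp
  abel

lemma sh_g_succ (hH : blk (-dM) 0 f dN * H + H * blk (-dM) 0 f dN = 1) (n : ℕ) :
    dM ∘ₗ b12 (shTerm H (n + 1)) - b12 (shTerm H (n + 1)) ∘ₗ dN =
      ∑ p ∈ antidiagonal n, b12 (shTerm H p.2) ∘ₗ b22 (shTerm H p.1)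
      - ∑ p ∈ antidiagonal n, (-b11 (shTerm H p.2)) ∘ₗ b12 (shTerm H p.1) := by
  have := congrArg b12 (shTerm_eq_succ _ _ hH n)
  simp only [b12_add, b12_mul, b11_blk, b12_blk, b21_blk, b22_blk, b12_neg, b12_sum,
    sum_add_distrib] at this
  rw [← Nat.sum_antidiagonal_swap (n := n)
      (f := fun p => b12 (shTerm H p.2) ∘ₗ b22 (shTerm H p.1)),
      ← Nat.sum_antidiagonal_swap (n := n)
      (f := fun p => (-b11 (shTerm H p.2)) ∘ₗ b12 (shTerm H p.1))]
  simp only [Prod.fst_swap, Prod.snd_swap, LinearMap.neg_comp, sum_neg_distrib,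
    LinearMap.zero_comp, LinearMap.comp_zero] at this ⊢
  rw [← sub_eq_zero] at this
  rw [← sub_eq_zero, ← neg_eq_zero, ← this]
  abel

lemma sh_h_zero (hH : blk (-dM) 0 f dN * H + H * blk (-dM) 0 f dN = 1) :
    dM ∘ₗ (-b11 (shTerm H 0)) + (-b11 (shTerm H 0)) ∘ₗ dM =
      LinearMap.id - b12 (shTerm H 0) ∘ₗ shF f H 0 := by
  have := congrArg b11 (shTerm_eq_zero _ _ hH)
  simp only [b11_add, b11_mul, b11_blk, b12_blk, b21_blk, b22_blk, b11_one] at this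
  rw [← this]
  ext1 x
  simp [shF]
  abel

lemma sh_h_succ (hH : blk (-dM) 0 f dN * H + H * blk (-dM) 0 f dN = 1) (n : ℕ) :
    dM ∘ₗ (-b11 (shTerm H (n + 1))) + (-b11 (shTerm H (n + 1))) ∘ₗ dM =
      0 - ∑ p ∈ antidiagonal (n + 1), b12 (shTerm H p.2) ∘ₗ shF f H p.1
      - ∑ p ∈ antidiagonal n, (-b11 (shTerm H p.2)) ∘ₗ (-b11 (shTerm H p.1)) := by
  have := congrArg b11 (shTerm_eq_succ _ _ hH n)
  simp only [b11_add, b11_mul, b11_blk, b12_blk, b21_blk, b22_blk, b11_neg, b11_sum,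
    sum_add_distrib] at this
  rw [Nat.sum_antidiagonal_succ]
  simp only [shF]
  rw [← Nat.sum_antidiagonal_swap (n := n)
      (f := fun p => b12 (shTerm H p.2) ∘ₗ b21 (shTerm H p.1)),
      ← Nat.sum_antidiagonal_swap (n := n)
      (f := fun p => (-b11 (shTerm H p.2)) ∘ₗ (-b11 (shTerm H p.1)))]
  simp only [Prod.fst_swap, Prod.snd_swap, LinearMap.neg_comp, LinearMap.comp_neg, neg_neg,
    LinearMap.zero_comp, LinearMap.comp_zero] at this ⊢
  rw [← sub_eq_zero] at this
  rw [← sub_eq_zero]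
  refine Eq.trans ?_ this
  abel

lemma sh_k_zero (hH : blk (-dM) 0 f dN * H + H * blk (-dM) 0 f dN = 1) :
    dN ∘ₗ b22 (shTerm H 0) + b22 (shTerm H 0) ∘ₗ dN =
      LinearMap.id - shF f H 0 ∘ₗ b12 (shTerm H 0) := by
  have := congrArg b22 (shTerm_eq_zero _ _ hH)
  simp only [b22_add, b22_mul, b11_blk, b12_blk, b21_blk, b22_blk, b22_one] at this
  rw [← this]
  ext1 x
  simp [shF]
  abel

lemma sh_k_succ (hH : blk (-dM) 0 f dN * H + H * blk (-dM) 0 f dN = 1) (n : ℕ) :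
    dN ∘ₗ b22 (shTerm H (n + 1)) + b22 (shTerm H (n + 1)) ∘ₗ dN =
      0 - ∑ p ∈ antidiagonal (n + 1), shF f H p.2 ∘ₗ b12 (shTerm H p.1)
      - ∑ p ∈ antidiagonal n, b22 (shTerm H p.2) ∘ₗ b22 (shTerm H p.1) := by
  have := congrArg b22 (shTerm_eq_succ _ _ hH n)
  simp only [b22_add, b22_mul, b11_blk, b12_blk, b21_blk, b22_blk, b22_neg, b22_sum,
    sum_add_distrib] at this
  rw [Nat.sum_antidiagonal_succ']
  simp only [shF]
  rw [← Nat.sum_antidiagonal_swap (n := n)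
      (f := fun p => b21 (shTerm H p.2) ∘ₗ b12 (shTerm H p.1)),
      ← Nat.sum_antidiagonal_swap (n := n)
      (f := fun p => b22 (shTerm H p.2) ∘ₗ b22 (shTerm H p.1))]
  simp only [Prod.fst_swap, Prod.snd_swap,
    LinearMap.zero_comp, LinearMap.comp_zero] at this ⊢
  rw [← sub_eq_zero] at this
  rw [← sub_eq_zero]
  refine Eq.trans ?_ this
  abel

end

end Core

section Total

/-- The total map associated to a cochain. -/
def shT {n : ℤ} (z : Cochain X Y n) : (∀ p, X.X p) →ₗ[R] (∀ p, Y.X p) :=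
  LinearMap.pi fun q => (z.v (q - n) q (by omega)).hom ∘ₗ LinearMap.proj (q - n)

lemma shT_apply {n : ℤ} (z : Cochain X Y n) (x : ∀ p, X.X p) (p q : ℤ) (h : p + n = q) :
    shT z x q = (z.v p q h).hom (x p) := by
  obtain rfl : p = q - n := by omega
  rfl

lemma shT_injective {n : ℤ} : Function.Injective (shT : Cochain X Y n → _) := by
  intro z w hzw
  ext p q hpq x
  classical
  have := congrFun (LinearMap.congr_fun hzw (Pi.single p x)) q
  rw [shT_apply _ _ p q hpq, shT_apply _ _ p q hpq] at this
  simpa using this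

lemma shT_comp {n₁ n₂ n₃ : ℤ} (z : Cochain X Y n₁) (w : Cochain Y Z n₂) (h : n₁ + n₂ = n₃) :
    shT (z.comp w h) = shT w ∘ₗ shT z := by
  ext x q
  rw [LinearMap.comp_apply, shT_apply w _ (q - n₂) q (by omega),
    shT_apply z _ (q - n₂ - n₁) (q - n₂) (by omega),
    shT_apply _ _ (q - n₂ - n₁) q (by omega),
    Cochain.comp_v z w h (q - n₂ - n₁) (q - n₂) q (by omega) (by omega)]
  rfl

lemma shT_add {n : ℤ} (z w : Cochain X Y n) : shT (z + w) = shT z + shT w := by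
  ext x q
  simp [shT]
lemma shT_sub {n : ℤ} (z w : Cochain X Y n) : shT (z - w) = shT z - shT w := by
  ext x q
  simp [shT]
lemma shT_neg {n : ℤ} (z : Cochain X Y n) : shT (-z) = - shT z := by
  ext x q
  simp [shT]
lemma shT_zero {n : ℤ} : shT (0 : Cochain X Y n) = 0 := by
  ext x q
  simp [shT]
lemma shT_one : shT (Cochain.ofHom (𝟙 X)) = LinearMap.id := by
  ext x q
  rw [shT_apply _ _ q q (by omega)]
  simp

/-- `shT` as an additive map. -/
def shTHom (X Y : CochainComplex (ModuleCat R) ℤ) (n : ℤ) :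
    Cochain X Y n →+ ((∀ p, X.X p) →ₗ[R] (∀ p, Y.X p)) :=
  AddMonoidHom.mk' shT shT_add

lemma shT_sum {n : ℤ} {ι : Type*} (s : Finset ι) (z : ι → Cochain X Y n) :
    shT (∑ i ∈ s, z i) = ∑ i ∈ s, shT (z i) := map_sum (shTHom X Y n) z s

lemma shT_zsmul {n : ℤ} (c : ℤ) (z : Cochain X Y n) :
    shT (c • z) = c • shT z := map_zsmul (shTHom X Y n) c z

/-- The total differential. -/
def shD (X : CochainComplex (ModuleCat R) ℤ) : (∀ p, X.X p) →ₗ[R] (∀ p, X.X p) :=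
  shT (Cochain.diff X)

lemma shT_δ_odd {n m : ℤ} (h : n + 1 = m) (hm : Odd m) (z : Cochain X Y n) :
    shT (δ n m z) = shD Y ∘ₗ shT z - shT z ∘ₗ shD X := by
  rw [shD, shD, ← shT_comp _ _ h, ← shT_comp _ _ (show 1 + n = m by omega), ← shT_sub]
  congr 1
  ext p q hpq : 1
  rw [δ_v n m h z p q hpq (q - 1) (p + 1) rfl rfl, Cochain.sub_v,
    Cochain.comp_v _ _ h p (q - 1) q (by omega) (by omega),
    Cochain.comp_v _ _ (show 1 + n = m by omega) p (p + 1) q (by omega) (by omega),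
    Int.negOnePow_odd m hm]
  simp [sub_eq_add_neg]

lemma shT_δ_even {n m : ℤ} (h : n + 1 = m) (hm : Even m) (z : Cochain X Y n) :
    shT (δ n m z) = shD Y ∘ₗ shT z + shT z ∘ₗ shD X := by
  rw [shD, shD, ← shT_comp _ _ h, ← shT_comp _ _ (show 1 + n = m by omega), ← shT_add]
  congr 1
  ext p q hpq : 1
  rw [δ_v n m h z p q hpq (q - 1) (p + 1) rfl rfl, Cochain.add_v,
    Cochain.comp_v _ _ h p (q - 1) q (by omega) (by omega),
    Cochain.comp_v _ _ (show 1 + n = m by omega) p (p + 1) q (by omega) (by omega),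
    Int.negOnePow_even m hm]
  simp

lemma shT_sComp (a : SHom X Y d₁) (b : SHom Y Z d₂) (h : d₁ + d₂ = d₃) (n : ℕ) :
    shT (sComp a b h n) = ∑ p ∈ Finset.HasAntidiagonal.antidiagonal n, shT (b p.2) ∘ₗ shT (a p.1) := by
  rw [sComp, shT_sum, Finset.Nat.sum_antidiagonal_eq_sum_range_succ_mk]
  simp only [shT_comp]
  exact Finset.sum_attach (Finset.range (n + 1)) (fun i => shT (b (n - i)) ∘ₗ shT (a i))

lemma shT_sEps_zero (a : SHom X Y d) (h : d + 2 = e) : shT (sEps a h 0) = 0 := by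
  simp [sEps, shT_zero]

lemma shT_sEps_succ (a : SHom X Y d) (h : d + 2 = e) (n : ℕ) :
    shT (sEps a h (n + 1)) = shT (a n) := by
  rw [sEps, dif_neg (Nat.succ_ne_zero n), shT_comp, shT_one, LinearMap.id_comp]
  rfl

lemma shT_sOne_zero : shT (sOne X 0) = LinearMap.id := by
  rw [sOne, dif_pos rfl, shT_comp, shT_one, LinearMap.id_comp]

lemma shT_sOne_succ (n : ℕ) : shT (sOne X (n + 1)) = 0 := by
  rw [sOne, dif_neg (Nat.succ_ne_zero n), shT_zero]

/-- Homogeneity of a total map. -/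
def shDeg (X Y : CochainComplex (ModuleCat R) ℤ) (n : ℤ)
    (φ : (∀ p, X.X p) →ₗ[R] (∀ p, Y.X p)) : Prop := ∃ z : Cochain X Y n, shT z = φ

lemma shDeg.comp {n m l : ℤ} {φ : (∀ p, X.X p) →ₗ[R] (∀ p, Y.X p)}
    {ψ : (∀ p, Y.X p) →ₗ[R] (∀ p, Z.X p)} (hψ : shDeg Y Z m ψ) (hφ : shDeg X Y n φ)
    (h : n + m = l) :
    shDeg X Z l (ψ ∘ₗ φ) := by
  obtain ⟨z, rfl⟩ := hφ
  obtain ⟨w, rfl⟩ := hψ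
  exact ⟨z.comp w h, shT_comp z w h⟩

lemma shDeg.add {n : ℤ} {φ ψ : (∀ p, X.X p) →ₗ[R] (∀ p, Y.X p)}
    (hφ : shDeg X Y n φ) (hψ : shDeg X Y n ψ) : shDeg X Y n (φ + ψ) := by
  obtain ⟨z, rfl⟩ := hφ
  obtain ⟨w, rfl⟩ := hψ
  exact ⟨_, shT_add z w⟩

lemma shDeg.neg {n : ℤ} {φ : (∀ p, X.X p) →ₗ[R] (∀ p, Y.X p)}
    (hφ : shDeg X Y n φ) : shDeg X Y n (-φ) := by
  obtain ⟨z, rfl⟩ := hφ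
  exact ⟨_, shT_neg z⟩

lemma shDeg.zsmul {n : ℤ} (c : ℤ) {φ : (∀ p, X.X p) →ₗ[R] (∀ p, Y.X p)}
    (hφ : shDeg X Y n φ) : shDeg X Y n (c • φ) := by
  obtain ⟨z, rfl⟩ := hφ
  exact ⟨_, shT_zsmul c z⟩

lemma shDeg.cast {n m : ℤ} {φ : (∀ p, X.X p) →ₗ[R] (∀ p, Y.X p)}
    (hφ : shDeg X Y n φ) (h : n = m) : shDeg X Y m φ := h ▸ hφ

/-- Homogeneity of a block endomorphism. -/
structure shBDeg (X Y : CochainComplex (ModuleCat R) ℤ) (n : ℤ)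
    (B : Module.End R ((∀ p, X.X p) × (∀ p, Y.X p))) : Prop where
  h11 : shDeg X X n (b11 B)
  h12 : shDeg Y X (n + 1) (b12 B)
  h21 : shDeg X Y (n - 1) (b21 B)
  h22 : shDeg Y Y n (b22 B)

lemma shBDeg.mul {n m l : ℤ} {A B : Module.End R ((∀ p, X.X p) × (∀ p, Y.X p))}
    (hA : shBDeg X Y n A) (hB : shBDeg X Y m B) (h : n + m = l) : shBDeg X Y l (A * B) where
  h11 := by
    rw [b11_mul]
    exact (hA.h11.comp hB.h11 (by omega)).add (hA.h12.comp hB.h21 (by omega))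
  h12 := by
    rw [b12_mul]
    exact (hA.h11.comp hB.h12 (by omega)).add (hA.h12.comp hB.h22 (by omega))
  h21 := by
    rw [b21_mul]
    exact (hA.h21.comp hB.h11 (by omega)).add (hA.h22.comp hB.h21 (by omega))
  h22 := by
    rw [b22_mul]
    exact (hA.h21.comp hB.h12 (by omega)).add (hA.h22.comp hB.h22 (by omega))

lemma shBDeg.zsmul {n : ℤ} (c : ℤ) {A : Module.End R ((∀ p, X.X p) × (∀ p, Y.X p))}
    (hA : shBDeg X Y n A) : shBDeg X Y n (c • A) where
  h11 := by
    have := hA.h11.zsmul c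
    convert this using 1
    ext; simp [b11]
  h12 := by
    have := hA.h12.zsmul c
    convert this using 1
    ext; simp [b12]
  h21 := by
    have := hA.h21.zsmul c
    convert this using 1
    ext; simp [b21]
  h22 := by
    have := hA.h22.zsmul c
    convert this using 1
    ext; simp [b22]

lemma shBDeg.pow_succ {A : Module.End R ((∀ p, X.X p) × (∀ p, Y.X p))}
    (hA : shBDeg X Y (-1) A) (n : ℕ) : shBDeg X Y (-1 - (n : ℤ)) (A ^ (n + 1)) := by
  induction n with
  | zero => simpa using hA
  | succ n ih =>
    rw [_root_.pow_succ]
    exact ih.mul hA (by push_cast; ring)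

lemma shBDeg.term {A : Module.End R ((∀ p, X.X p) × (∀ p, Y.X p))}
    (hA : shBDeg X Y (-1) A) (n : ℕ) : shBDeg X Y (-1 - 2 * (n : ℤ)) (shTerm A n) := by
  have := (hA.pow_succ (2 * n)).zsmul (shCoef n)
  rw [Nat.cast_mul] at this
  exact this

end Total

/-- homotopy equivalences promote to strong homotopy
equivalences.  Given homotopy-equivalence data `f₀, g₀, h₀, k₀` between cochain
complexes `X` and `Y`, after replacing `h₀` by `h₀' := h₀ − g₀∘(f₀∘h₀ − k₀∘f₀)`,
there exist formal power series `f(ε), g(ε), h(ε), k(ε)` in a degree-2 variable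
`ε`, with constant terms `f₀, g₀, h₀', k₀`, satisfying the four
strong-homotopy-equivalence equations. -/
theorem homotopy_equivalence_promotes_to_strong
    (X Y : CochainComplex (ModuleCat R) ℤ)
    (f₀ : Cochain X Y 0) (g₀ : Cochain Y X 0)
    (h₀ : Cochain X X (-1)) (k₀ : Cochain Y Y (-1))
    (hf₀ : δ 0 1 f₀ = 0) (hg₀ : δ 0 1 g₀ = 0)
    (hh₀ : δ (-1) 0 h₀ = Cochain.ofHom (𝟙 X) - f₀.comp g₀ (by ring))
    (hk₀ : δ (-1) 0 k₀ = Cochain.ofHom (𝟙 Y) - g₀.comp f₀ (by ring)) :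
    ∃ (f : SHom X Y 0) (g : SHom Y X 0) (h : SHom X X (-1)) (k : SHom Y Y (-1)),
      f 0 = f₀.comp (Cochain.ofHom (𝟙 Y)) (by omega) ∧
      g 0 = g₀.comp (Cochain.ofHom (𝟙 X)) (by omega) ∧
      h 0 = (h₀ - (h₀.comp f₀ (show (-1:ℤ) + 0 = -1 by ring)
          - f₀.comp k₀ (show (0:ℤ) + (-1) = -1 by ring)).comp g₀
            (show (-1:ℤ) + 0 = -1 by ring)).comp (Cochain.ofHom (𝟙 X)) (by omega) ∧
      k 0 = k₀.comp (Cochain.ofHom (𝟙 Y)) (by omega) ∧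
      sδ 0 1 f = sEps (sComp h f (show (-1:ℤ) + 0 = -1 by ring)
          - sComp f k (show (0:ℤ) + (-1) = -1 by ring)) (by ring) ∧
      sδ 0 1 g = sEps (sComp k g (show (-1:ℤ) + 0 = -1 by ring)
          - sComp g h (show (0:ℤ) + (-1) = -1 by ring)) (by ring) ∧
      sδ (-1) 0 h = sOne X - sComp f g (show (0:ℤ) + 0 = 0 by ring)
          - sEps (sComp h h (show (-1:ℤ) + (-1) = -2 by ring)) (by ring) ∧
      sδ (-1) 0 k = sOne Y - sComp g f (show (0:ℤ) + 0 = 0 by ring)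
          - sEps (sComp k k (show (-1:ℤ) + (-1) = -2 by ring)) (by ring) := by
  have e1 := congrArg shT hf₀
  have e2 := congrArg shT hg₀
  have e3 := congrArg shT hh₀
  have e4 := congrArg shT hk₀
  rw [shT_δ_odd (by omega) (by decide), shT_zero] at e1 e2
  rw [shT_δ_even (by omega) (by decide), shT_sub, shT_one, shT_comp] at e3 e4
  have hH := shH_contracting (shD X) (shD Y) (shT f₀) (shT g₀) (shT h₀) (shT k₀) e1 e2 e3 e4
  have hw : shDeg X Y (-1) (shT f₀ ∘ₗ shT h₀ - shT k₀ ∘ₗ shT f₀) :=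
    ⟨h₀.comp f₀ (show (-1:ℤ) + 0 = -1 by ring) - f₀.comp k₀ (show (0:ℤ) + (-1) = -1 by ring), by
      rw [shT_sub, shT_comp, shT_comp]⟩
  have hB : shBDeg X Y (-1) (shH (shT f₀) (shT g₀) (shT h₀) (shT k₀)) := by
    constructor
    · rw [shH, b11_blk]
      apply shDeg.neg
      rw [sub_eq_add_neg]
      exact shDeg.add ⟨_, rfl⟩ (shDeg.neg (shDeg.comp ⟨g₀, rfl⟩ hw (by omega)))
    · rw [shH, b12_blk]; exact ⟨g₀, rfl⟩
    · rw [shH, b21_blk]; exact shDeg.comp ⟨k₀, rfl⟩ hw (by omega)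
    · rw [shH, b22_blk]; exact ⟨k₀, rfl⟩
  generalize hH0 : shH (shT f₀) (shT g₀) (shT h₀) (shT k₀) = H at hH hB
  have hf : ∀ n : ℕ, shDeg X Y (0 - 2 * (n : ℤ)) (shF (shT f₀) H n) := by
    intro n
    cases n with
    | zero => exact shDeg.cast ⟨f₀, rfl⟩ (by simp)
    | succ n => exact (hB.term n).h21.cast (by push_cast; ring)
  have hg : ∀ n : ℕ, shDeg Y X (0 - 2 * (n : ℤ)) (b12 (shTerm H n)) := fun n =>
    (hB.term n).h12.cast (by ring)
  have hh : ∀ n : ℕ, shDeg X X (-1 - 2 * (n : ℤ)) (-b11 (shTerm H n)) := fun n =>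
    (hB.term n).h11.neg
  have hk : ∀ n : ℕ, shDeg Y Y (-1 - 2 * (n : ℤ)) (b22 (shTerm H n)) := fun n =>
    (hB.term n).h22
  choose f hf using hf
  choose g hg using hg
  choose h hh using hh
  choose k hk using hk
  refine ⟨f, g, h, k, ?_, ?_, ?_, ?_, ?_, ?_, ?_, ?_⟩
  · apply shT_injective
    rw [hf, shT_comp, shT_one, LinearMap.id_comp, shF]
  · apply shT_injective
    rw [hg, shT_comp, shT_one, LinearMap.id_comp, shTerm_zero, ← hH0, shH, b12_blk]
  · apply shT_injective
    rw [hh, shT_comp, shT_one, LinearMap.id_comp, shTerm_zero, ← hH0, shH, b11_blk, neg_neg,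
      shT_sub, shT_comp, shT_sub, shT_comp, shT_comp]
  · apply shT_injective
    rw [hk, shT_comp, shT_one, LinearMap.id_comp, shTerm_zero, ← hH0, shH, b22_blk]
  · funext n
    apply shT_injective
    rw [sδ, shT_δ_odd (by ring) ⟨-n, by ring⟩]
    cases n with
    | zero => rw [shT_sEps_zero, hf]; exact e1
    | succ n =>
      rw [shT_sEps_succ, Pi.sub_apply, shT_sub, shT_sComp, shT_sComp]
      simp only [hf, hh, hk]
      exact sh_f_succ _ _ _ _ hH n
  · funext n
    apply shT_injective
    rw [sδ, shT_δ_odd (by ring) ⟨-n, by ring⟩]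
    cases n with
    | zero => rw [shT_sEps_zero, hg]; exact sh_g_zero _ _ _ _ hH
    | succ n =>
      rw [shT_sEps_succ, Pi.sub_apply, shT_sub, shT_sComp, shT_sComp]
      simp only [hg, hh, hk]
      exact sh_g_succ _ _ _ _ hH n
  · funext n
    apply shT_injective
    rw [sδ, shT_δ_even (by ring) ⟨-n, by ring⟩, Pi.sub_apply, Pi.sub_apply, shT_sub, shT_sub]
    cases n with
    | zero =>
      rw [shT_sEps_zero, shT_sOne_zero, shT_sComp]
      simp only [hf, hg, hh, sub_zero, Finset.HasAntidiagonal.antidiagonal_zero,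
        Finset.sum_singleton]
      exact sh_h_zero _ _ _ _ hH
    | succ n =>
      rw [shT_sEps_succ, shT_sOne_succ, shT_sComp, shT_sComp]
      simp only [hf, hg, hh]
      exact sh_h_succ _ _ _ _ hH n
  · funext n
    apply shT_injective
    rw [sδ, shT_δ_even (by ring) ⟨-n, by ring⟩, Pi.sub_apply, Pi.sub_apply, shT_sub, shT_sub]
    cases n with
    | zero =>
      rw [shT_sEps_zero, shT_sOne_zero, shT_sComp]
      simp only [hf, hg, hk, sub_zero, Finset.HasAntidiagonal.antidiagonal_zero,
        Finset.sum_singleton]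
      exact sh_k_zero _ _ _ _ hH
    | succ n =>
      rw [shT_sEps_succ, shT_sOne_succ, shT_sComp, shT_sComp]
      simp only [hf, hg, hk]
      exact sh_k_succ _ _ _ _ hH n

end
end

section
/- (Uncurved homological perturbation without strong data) Let f₀, g₀, h₀, k₀ be homotopy-equivalence data between complexes X and Y (d(f₀)=d(g₀)=0, d(h₀)=id_X−g₀f₀, d(k₀)=id_Y−f₀g₀), and let α ∈ End^1(X) satisfy d(α)+α²=0 with id_X + α∘h₀ invertible. Define F₀ := f₀(id+αh₀)^{−1}, G₀ := (id+h₀α)^{−1}g₀, H₀ := h₀(id+αh₀)^{−1}, β := f₀∘α∘(id+h₀α)^{−1}∘g₀. Then: (a) d(β)+β² = 0, so (Y, δ_Y+β) is a complex; (b) F₀ and G₀ are closed degree-zero chain maps tw_α(X) → tw_β(Y) and tw_β(Y) → tw_α(X) respectively; (c) d(H₀) + α∘H₀ + H₀∘α = id_X − G₀∘F₀; (d) F₀ and G₀ are mutually inverse homotopy equivalences tw_α(X) ≃ tw_β(Y). -/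
open CategoryTheory CochainComplex CochainComplex.HomComplex

namespace PertAux

universe w₁ w₂

variable {R : Type w₁} [CommRing R]

/-- Total operator on the product of all degrees attached to a cochain. -/
noncomputable def T {X Y : CochainComplex (ModuleCat.{w₂} R) ℤ} {n : ℤ} (z : Cochain X Y n) :
    ((p : ℤ) → X.X p) →ₗ[R] ((q : ℤ) → Y.X q) :=
  LinearMap.pi fun q => (z.v (q - n) q (by ring)).hom ∘ₗ LinearMap.proj (q - n)

/-- Total differential. -/
noncomputable def D (X : CochainComplex (ModuleCat.{w₂} R) ℤ) :
    ((p : ℤ) → X.X p) →ₗ[R] ((q : ℤ) → X.X q) :=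
  LinearMap.pi fun q => (X.d (q - 1) q).hom ∘ₗ LinearMap.proj (q - 1)

variable {X Y Z : CochainComplex (ModuleCat.{w₂} R) ℤ}

lemma T_apply {n : ℤ} (z : Cochain X Y n) (x : (p : ℤ) → X.X p) (p q : ℤ) (h : p + n = q) :
    T z x q = (z.v p q h).hom (x p) := by
  obtain rfl : p = q - n := by lia
  rfl

lemma D_apply (x : (p : ℤ) → X.X p) (p q : ℤ) (h : p + 1 = q) :
    D X x q = (X.d p q).hom (x p) := by
  obtain rfl : p = q - 1 := by lia
  rfl

lemma T_inj {n : ℤ} {z z' : Cochain X Y n} (h : ∀ x, T z x = T z' x) : z = z' := by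
  ext p q hpq x
  have := congrFun (h (Pi.single p x)) q
  rw [T_apply _ _ p q hpq, T_apply _ _ p q hpq] at this
  simpa using this

lemma T_add {n : ℤ} (z z' : Cochain X Y n) (x) : T (z + z') x = T z x + T z' x := by
  ext q
  simp [T]

lemma T_sub {n : ℤ} (z z' : Cochain X Y n) (x) : T (z - z') x = T z x - T z' x := by
  ext q
  simp [T]

lemma T_zero {n : ℤ} (x) : T (0 : Cochain X Y n) x = 0 := by
  ext q
  simp [T]

lemma T_id (x) : T (Cochain.ofHom (𝟙 X)) x = x := by
  ext q
  rw [T_apply _ _ q q (by simp)]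
  simp

lemma T_comp {n m k : ℤ} (z : Cochain X Y n) (z' : Cochain Y Z m) (h : n + m = k) (x) :
    T (z.comp z' h) x = T z' (T z x) := by
  ext q
  rw [T_apply _ _ (q - k) q (by simp), T_apply z' _ (q - m) q (by simp),
    T_apply z _ (q - k) (q - m) (by lia),
    Cochain.comp_v z z' h (q - k) (q - m) q (by lia) (by lia)]
  simp

lemma T_δ {n m : ℤ} (h : n + 1 = m) (z : Cochain X Y n) (x) :
    T (δ n m z) x = D Y (T z x) + m.negOnePow • T z (D X x) := by
  ext q
  rw [T_apply _ _ (q - m) q (by simp), Pi.add_apply, D_apply _ (q - 1) q (by simp),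
    T_apply z _ (q - m) (q - 1) (by lia), Pi.smul_apply,
    T_apply z _ (q - m + 1) q (by lia), D_apply _ (q - m) (q - m + 1) rfl,
    δ_v n m h z (q - m) q (by lia) (q - 1) (q - m + 1) rfl rfl]
  simp [Units.smul_def]

lemma T_δ0 (z : Cochain X Y (-1)) (x) :
    T (δ (-1) 0 z) x = D Y (T z x) + T z (D X x) := by
  rw [T_δ (by simp)]; simp

lemma T_δ1 (z : Cochain X Y 0) (x) :
    T (δ 0 1 z) x = D Y (T z x) - T z (D X x) := by
  rw [T_δ (by simp)]; simp [sub_eq_add_neg]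

lemma T_δ2 (z : Cochain X Y 1) (x) :
    T (δ 1 2 z) x = D Y (T z x) + T z (D X x) := by
  rw [T_δ (by simp)]; simp [Int.negOnePow_even 2 (by decide)]

end PertAux

/-- uncurved homological perturbation without strong data.
Let `f₀, g₀, h₀, k₀` be homotopy-equivalence data between complexes `X` and `Y`,
and let `α ∈ End¹(X)` satisfy `d(α) + α² = 0` with `id_X + α∘h₀` invertible, with
two-sided inverse `u` (and `v := id − h₀∘u∘α` the inverse of `id_X + h₀α`).
Define `F₀ := f₀(id+αh₀)^{-1}`, `G₀ := (id+h₀α)^{-1}g₀`, `H₀ := h₀(id+αh₀)^{-1}`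
and `β := f₀∘α∘(id+h₀α)^{-1}∘g₀`.  Then:
(a) `d(β) + β² = 0`;
(b) `F₀` and `G₀` are closed degree-zero morphisms `tw_α(X) → tw_β(Y)` and
`tw_β(Y) → tw_α(X)`;
(c) `d(H₀) + α∘H₀ + H₀∘α = id_X − G₀∘F₀`;
(d) `F₀` and `G₀` are mutually inverse homotopy equivalences
`tw_α(X) ≃ tw_β(Y)`, i.e. there is moreover `K₀ ∈ End^{-1}(Y)` with
`d(K₀) + β∘K₀ + K₀∘β = id_Y − G₀∘F₀` on the `Y` side.
(Compositions are written diagrammatically: `φ∘ψ = ψ.comp φ`.) -/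
theorem uncurved_perturbation_without_strong_data
    {R : Type*} [CommRing R]
    (X Y : CochainComplex (ModuleCat R) ℤ)
    (f₀ : Cochain X Y 0) (g₀ : Cochain Y X 0)
    (h₀ : Cochain X X (-1)) (k₀ : Cochain Y Y (-1))
    (hf₀ : δ 0 1 f₀ = 0) (hg₀ : δ 0 1 g₀ = 0)
    (hh₀ : δ (-1) 0 h₀ = Cochain.ofHom (𝟙 X) - f₀.comp g₀ (by ring))
    (hk₀ : δ (-1) 0 k₀ = Cochain.ofHom (𝟙 Y) - g₀.comp f₀ (by ring))
    (α : Cochain X X 1)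
    (hα : δ 1 2 α + α.comp α (by ring) = 0)
    (u : Cochain X X 0)
    (hu₁ : (Cochain.ofHom (𝟙 X) + h₀.comp α (by ring)).comp u (by ring)
        = Cochain.ofHom (𝟙 X))
    (hu₂ : u.comp (Cochain.ofHom (𝟙 X) + h₀.comp α (by ring)) (by ring)
        = Cochain.ofHom (𝟙 X))
    (v : Cochain X X 0)
    (hv : v = Cochain.ofHom (𝟙 X)
        - α.comp (u.comp h₀ (show (0:ℤ) + (-1) = -1 by ring)) (show (1:ℤ) + (-1) = 0 by ring))
    (F₀ : Cochain X Y 0) (hF₀ : F₀ = u.comp f₀ (by ring))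
    (G₀ : Cochain Y X 0) (hG₀ : G₀ = g₀.comp v (by ring))
    (H₀ : Cochain X X (-1)) (hH₀ : H₀ = u.comp h₀ (by ring))
    (β : Cochain Y Y 1)
    (hβ : β = g₀.comp (v.comp (α.comp f₀ (show (1:ℤ) + 0 = 1 by ring))
        (show (0:ℤ) + 1 = 1 by ring)) (show (0:ℤ) + 1 = 1 by ring)) :
    -- (a) β is a Maurer–Cartan element, so `tw_β(Y)` is a complex
    δ 1 2 β + β.comp β (by ring) = 0 ∧
    -- (b) F₀ and G₀ are closed degree-zero morphisms of twisted complexes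
    δ 0 1 F₀ + F₀.comp β (by ring) - α.comp F₀ (by ring) = 0 ∧
    δ 0 1 G₀ + G₀.comp α (by ring) - β.comp G₀ (by ring) = 0 ∧
    -- (c) H₀ is a homotopy from G₀∘F₀ to the identity
    (δ (-1) 0 H₀ + H₀.comp α (by ring) + α.comp H₀ (by ring)
      = Cochain.ofHom (𝟙 X) - F₀.comp G₀ (by ring)) ∧
    -- (d) F₀, G₀ are mutually inverse homotopy equivalences tw_α(X) ≃ tw_β(Y)
    ∃ K₀ : Cochain Y Y (-1),
      δ (-1) 0 K₀ + K₀.comp β (by ring) + β.comp K₀ (by ring)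
        = Cochain.ofHom (𝟙 Y) - G₀.comp F₀ (by ring) := by
  have ef : ∀ x, PertAux.D Y (PertAux.T f₀ x) = PertAux.T f₀ (PertAux.D X x) := fun x => by
    have := congrArg (fun z => PertAux.T z x) hf₀
    simp only [PertAux.T_δ1, PertAux.T_zero] at this
    exact sub_eq_zero.1 this
  have eg : ∀ x, PertAux.D X (PertAux.T g₀ x) = PertAux.T g₀ (PertAux.D Y x) := fun x => by
    have := congrArg (fun z => PertAux.T z x) hg₀
    simp only [PertAux.T_δ1, PertAux.T_zero] at this
    exact sub_eq_zero.1 this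
  have eh : ∀ x, PertAux.D X (PertAux.T h₀ x) = x - PertAux.T g₀ (PertAux.T f₀ x) - PertAux.T h₀ (PertAux.D X x) := fun x => by
    have := congrArg (fun z => PertAux.T z x) hh₀
    simp only [PertAux.T_δ0, PertAux.T_sub, PertAux.T_id, PertAux.T_comp] at this
    rw [← this]; abel
  have ek : ∀ x, PertAux.D Y (PertAux.T k₀ x) = x - PertAux.T f₀ (PertAux.T g₀ x) - PertAux.T k₀ (PertAux.D Y x) := fun x => by
    have := congrArg (fun z => PertAux.T z x) hk₀
    simp only [PertAux.T_δ0, PertAux.T_sub, PertAux.T_id, PertAux.T_comp] at this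
    rw [← this]; abel
  have ea : ∀ x, PertAux.D X (PertAux.T α x) = - PertAux.T α (PertAux.D X x) - PertAux.T α (PertAux.T α x) := fun x => by
    have := congrArg (fun z => PertAux.T z x) hα
    simp only [PertAux.T_δ2, PertAux.T_add, PertAux.T_zero, PertAux.T_comp] at this
    rw [← sub_eq_zero, ← this]; abel
  have eu₁ : ∀ x, PertAux.T u x + PertAux.T u (PertAux.T α (PertAux.T h₀ x)) = x := fun x => by
    have := congrArg (fun z => PertAux.T z x) hu₁
    simpa only [PertAux.T_add, PertAux.T_id, PertAux.T_comp, map_add] using this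
  have eu₂ : ∀ x, PertAux.T u x + PertAux.T α (PertAux.T h₀ (PertAux.T u x)) = x := fun x => by
    have := congrArg (fun z => PertAux.T z x) hu₂
    simpa only [PertAux.T_add, PertAux.T_id, PertAux.T_comp, map_add] using this
  -- the transferred operator
  obtain ⟨A, hA⟩ : ∃ A : Cochain X X 1, A = α.comp u (add_zero 1) := ⟨_, rfl⟩
  have eA : ∀ x, PertAux.T u (PertAux.T α x) = PertAux.T A x := fun x => by rw [hA, PertAux.T_comp]
  have eu : ∀ x, PertAux.T u x = x - PertAux.T A (PertAux.T h₀ x) := fun x => by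
    rw [← eA, eq_sub_iff_add_eq]; exact eu₁ x
  have eαhA : ∀ x, PertAux.T α (PertAux.T h₀ (PertAux.T A x)) = PertAux.T α x - PertAux.T A x := fun x => by
    rw [← eA, eq_sub_iff_add_eq, add_comm]; exact eu₂ _
  have ev : ∀ x, PertAux.T v x = x - PertAux.T h₀ (PertAux.T A x) := fun x => by
    rw [hv]; simp only [PertAux.T_sub, PertAux.T_id, PertAux.T_comp, eA]
  have eDA : ∀ x, PertAux.D X (PertAux.T A x) = - PertAux.T A (PertAux.D X x) - PertAux.T A (PertAux.T g₀ (PertAux.T f₀ (PertAux.T A x))) := fun x => by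
    set y := PertAux.D X (PertAux.T A x) + PertAux.T A (PertAux.D X x) + PertAux.T A (PertAux.T g₀ (PertAux.T f₀ (PertAux.T A x))) with hy
    have hw : y + PertAux.T α (PertAux.T h₀ y) = 0 := by
      have e1 : PertAux.T α (PertAux.T h₀ (PertAux.D X (PertAux.T A x))) = PertAux.T α (PertAux.T A x) - PertAux.T α (PertAux.T g₀ (PertAux.T f₀ (PertAux.T A x)))
          - PertAux.T α (PertAux.D X (PertAux.T h₀ (PertAux.T A x))) := by
        rw [eh]; simp only [map_sub]; abel
      have e2 : PertAux.T α (PertAux.D X (PertAux.T h₀ (PertAux.T A x))) = - PertAux.D X (PertAux.T α (PertAux.T h₀ (PertAux.T A x)))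
          - PertAux.T α (PertAux.T α (PertAux.T h₀ (PertAux.T A x))) := by
        rw [ea]; abel
      rw [hy]
      simp only [map_add, e1, e2, eαhA, map_sub, ea]
      abel
    have : y = 0 := by
      have h1 := eu₁ y
      rw [← map_add, hw, map_zero] at h1
      exact h1.symm
    rw [hy] at this
    rw [← sub_eq_zero, ← this]; abel
  have eF : ∀ x, PertAux.T F₀ x = PertAux.T f₀ x - PertAux.T f₀ (PertAux.T A (PertAux.T h₀ x)) := fun x => by
    rw [hF₀, PertAux.T_comp, eu, map_sub]
  have eG : ∀ x, PertAux.T G₀ x = PertAux.T g₀ x - PertAux.T h₀ (PertAux.T A (PertAux.T g₀ x)) := fun x => by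
    rw [hG₀, PertAux.T_comp, ev]
  have eH : ∀ x, PertAux.T H₀ x = PertAux.T h₀ x - PertAux.T h₀ (PertAux.T A (PertAux.T h₀ x)) := fun x => by
    rw [hH₀, PertAux.T_comp, eu, map_sub]
  have eβ : ∀ x, PertAux.T β x = PertAux.T f₀ (PertAux.T A (PertAux.T g₀ x)) := fun x => by
    rw [hβ]; simp only [PertAux.T_comp, ev, map_sub, eαhA]; abel_nf
  have eAhα : ∀ x, PertAux.T A (PertAux.T h₀ (PertAux.T α x)) = PertAux.T α x - PertAux.T A x := fun x => by
    rw [← eA, ← eA, eq_sub_iff_add_eq, add_comm]; exact eu₁ _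
  refine ⟨?_, ?_, ?_, ?_, ?_⟩
  · refine PertAux.T_inj fun x => ?_
    simp only [PertAux.T_δ2, PertAux.T_add, PertAux.T_zero, PertAux.T_comp, eβ, ef, eg, eDA, map_sub, map_neg]
    abel
  · refine PertAux.T_inj fun x => ?_
    simp only [PertAux.T_δ1, PertAux.T_add, PertAux.T_sub, PertAux.T_zero, PertAux.T_comp, eβ, eF, ef, eg, eh, eDA, eAhα, map_sub, map_neg]
    abel
  · refine PertAux.T_inj fun x => ?_
    simp only [PertAux.T_δ1, PertAux.T_add, PertAux.T_sub, PertAux.T_zero, PertAux.T_comp, eβ, eG, ef, eg, eh, eDA, eαhA, map_sub, map_neg]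
    abel
  · refine PertAux.T_inj fun x => ?_
    simp only [PertAux.T_δ0, PertAux.T_add, PertAux.T_sub, PertAux.T_id, PertAux.T_comp, eF, eG, eH, ef, eg, eh, eDA, eαhA, eAhα,
      map_sub, map_neg]
    abel
  · -- coherent homotopies
    let c : Cochain X Y (-1) := h₀.comp f₀ (add_zero _) - f₀.comp k₀ (zero_add _)
    let k : Cochain Y Y (-1) := k₀ + g₀.comp c (zero_add _)
    let m₀ : Cochain X Y (-2) := 0 - h₀.comp c (by norm_num)
    let e : Cochain Y X (-1) := g₀.comp h₀ (zero_add _) - k.comp g₀ (add_zero _)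
    let n : Cochain Y X (-2) := (k.comp k (by norm_num : (-1 : ℤ) + -1 = -2)
      + g₀.comp m₀ (zero_add _)).comp g₀ (add_zero _) + e.comp h₀ (by norm_num)
    let w : Cochain X X (-2) := m₀.comp g₀ (add_zero _) - f₀.comp n (zero_add _)
      + h₀.comp h₀ (by norm_num)
    let m : Cochain X Y (-2) := m₀ - w.comp f₀ (add_zero _)
    let p : Cochain X X (-3) := w.comp h₀ (by norm_num)
    let gA : Cochain Y X 1 := g₀.comp A (zero_add _)
    let Af : Cochain X Y 1 := A.comp f₀ (add_zero _)
    have ec : ∀ x, PertAux.T c x = PertAux.T f₀ (PertAux.T h₀ x) - PertAux.T k₀ (PertAux.T f₀ x) := fun x => by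
      simp only [c, PertAux.T_sub, PertAux.T_comp]
    have dc : ∀ x, PertAux.D Y (PertAux.T c x) = - PertAux.T c (PertAux.D X x) := fun x => by
      simp only [ec, map_sub, ef, eh, ek]; abel
    have ekk : ∀ x, PertAux.T k x = PertAux.T k₀ x + PertAux.T c (PertAux.T g₀ x) := fun x => by
      simp only [k, PertAux.T_add, PertAux.T_comp]
    have dk : ∀ x, PertAux.D Y (PertAux.T k x) = x - PertAux.T f₀ (PertAux.T g₀ x) - PertAux.T k (PertAux.D Y x) := fun x => by
      simp only [ekk, map_add, ek, dc, eg]; abel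
    have em₀ : ∀ x, PertAux.T m₀ x = - PertAux.T c (PertAux.T h₀ x) := fun x => by
      simp only [m₀, PertAux.T_sub, PertAux.T_zero, PertAux.T_comp]; abel
    have dm₀ : ∀ x, PertAux.D Y (PertAux.T m₀ x) = PertAux.T f₀ (PertAux.T h₀ x) - PertAux.T k (PertAux.T f₀ x) + PertAux.T m₀ (PertAux.D X x) := fun x => by
      simp only [em₀, map_neg, ef, ek, eh, map_sub, ekk, ec]; abel
    have ee : ∀ x, PertAux.T e x = PertAux.T h₀ (PertAux.T g₀ x) - PertAux.T g₀ (PertAux.T k x) := fun x => by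
      simp only [e, PertAux.T_sub, PertAux.T_comp]
    have en : ∀ x, PertAux.T n x = PertAux.T g₀ (PertAux.T k (PertAux.T k x)) + PertAux.T g₀ (PertAux.T m₀ (PertAux.T g₀ x)) + PertAux.T h₀ (PertAux.T e x) :=
      fun x => by simp only [n, PertAux.T_add, PertAux.T_comp, map_add]
    have dn : ∀ x, PertAux.D X (PertAux.T n x) = PertAux.T h₀ (PertAux.T g₀ x) - PertAux.T g₀ (PertAux.T k x) + PertAux.T n (PertAux.D Y x) := fun x => by
      simp only [en, ee, map_add, map_sub, eg, eh, dk, dm₀, ef]; abel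
    have ew : ∀ x, PertAux.T w x = PertAux.T g₀ (PertAux.T m₀ x) - PertAux.T n (PertAux.T f₀ x) + PertAux.T h₀ (PertAux.T h₀ x) := fun x => by
      simp only [w, PertAux.T_add, PertAux.T_sub, PertAux.T_comp]
    have dw : ∀ x, PertAux.D X (PertAux.T w x) = PertAux.T w (PertAux.D X x) := fun x => by
      simp only [ew, map_add, map_sub, eg, eh, dn, dm₀, ef]; abel
    have em : ∀ x, PertAux.T m x = PertAux.T m₀ x - PertAux.T f₀ (PertAux.T w x) := fun x => by
      simp only [m, PertAux.T_sub, PertAux.T_comp]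
    have dm : ∀ x, PertAux.D Y (PertAux.T m x) = PertAux.T f₀ (PertAux.T h₀ x) - PertAux.T k (PertAux.T f₀ x) + PertAux.T m (PertAux.D X x) := fun x => by
      simp only [em, map_sub, dm₀, ef, dw]; abel
    have dp : ∀ x, PertAux.D X (PertAux.T p x) = PertAux.T g₀ (PertAux.T m x) - PertAux.T n (PertAux.T f₀ x) + PertAux.T h₀ (PertAux.T h₀ x)
        - PertAux.T p (PertAux.D X x) := fun x => by
      simp only [p, PertAux.T_comp, eh, dw, em, map_sub]
      nth_rewrite 1 [ew]
      abel
    clear_value p m n k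
    refine ⟨k + gA.comp m (by norm_num) - n.comp Af (by norm_num)
      + gA.comp (p.comp Af (by norm_num : (-3 : ℤ) + 1 = -2)) (by norm_num), PertAux.T_inj fun x => ?_⟩
    simp only [PertAux.T_δ0, PertAux.T_add, PertAux.T_sub, PertAux.T_id, PertAux.T_comp, gA, Af, eF, eG, eβ, ef, eg, eh, dk, dm, dn, dp,
      eDA, map_add, map_sub, map_neg]
    abel
end
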